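/- arXiv:math/0606620 — 2 statements merged into one kernel-verified Lean document; each statement's English description precedes it below -/
import Mathlib

section
/- Let ν₀ be a centered infinitely divisible Borel probability measure on H with ∫_H ‖x‖² ν₀(dx) < ∞, and let log ν̂₀ be the unique continuous function on H with log ν̂₀(0) = 0 and ν̂₀(a) = exp{log ν̂₀(a)}. Then the formula μ̂_t(a) = exp{∫_0^t log ν̂₀(T_s^* a) ds}, t ≥ 0, a ∈ H, defines a family (μ_t)_{t≥0} of Borel probability measures on H that is a centered SC-semigroup associated with (T_t)_{t≥0}, and for every a ∈ H the function t ↦ μ̂_t(a) is differentiable at t = 0. -/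
open MeasureTheory Real Filter
open scoped ENNReal InnerProductSpace NNReal

noncomputable section

/-- A strongly continuous semigroup of bounded linear operators on `H`. -/
def IsC0 {H : Type*} [NormedAddCommGroup H] [NormedSpace ℝ H]
    (T : ℝ → H →L[ℝ] H) : Prop :=
  T 0 = ContinuousLinearMap.id ℝ H ∧
  (∀ s t : ℝ, 0 ≤ s → 0 ≤ t → T (s + t) = (T s).comp (T t)) ∧
  ∀ x : H, ContinuousOn (fun t => T t x) (Set.Ici 0)

/-- Convolution of two measures on an additive measurable group. -/
def mconv {G : Type*} [MeasurableSpace G] [Add G] (μ ν : Measure G) : Measure G :=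
  (μ.prod ν).map fun p => p.1 + p.2

/-- A skew convolution semigroup (SC-semigroup) associated with `(T_t)`. -/
def IsSC {H : Type*} [NormedAddCommGroup H] [NormedSpace ℝ H] [MeasurableSpace H]
    (T : ℝ → H →L[ℝ] H) (μ : ℝ → Measure H) : Prop :=
  (∀ t : ℝ, 0 ≤ t → IsProbabilityMeasure (μ t)) ∧
  ∀ r t : ℝ, 0 ≤ r → 0 ≤ t → μ (r + t) = mconv ((μ r).map (T t)) (μ t)

/-- The characteristic functional `μ̂(a) = ∫_H e^{i⟨x,a⟩} μ(dx)`. -/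
def charFn {H : Type*} [NormedAddCommGroup H] [InnerProductSpace ℝ H] [MeasurableSpace H]
    (μ : Measure H) (a : H) : ℂ :=
  ∫ x, Complex.exp ((⟪x, a⟫_ℝ : ℂ) * Complex.I) ∂μ

/-- `n`-fold convolution power of a measure. -/
def convPow {G : Type*} [MeasurableSpace G] [AddMonoid G] (ν : Measure G) : ℕ → Measure G
  | 0 => Measure.dirac 0
  | n + 1 => mconv (convPow ν n) ν

/-- Infinite divisibility. -/
def IsInfDiv {G : Type*} [MeasurableSpace G] [AddMonoid G] (μ : Measure G) : Prop :=
  ∀ n : ℕ, 1 ≤ n → ∃ ν : Measure G, IsProbabilityMeasure ν ∧ μ = convPow ν n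

section CenteredMoments

set_option linter.unusedSectionVars false

open Topology
open scoped Convolution

variable {H : Type*} [NormedAddCommGroup H] [InnerProductSpace ℝ H] [CompleteSpace H]
  [MeasurableSpace H] [BorelSpace H] [SecondCountableTopology H]

/-- A centered probability measure with finite second moment. -/
structure IsCenteredSq (μ : Measure H) : Prop where
  prob : IsProbabilityMeasure μ
  memLp : MemLp id 2 μ
  mean : ∫ x, x ∂μ = 0

lemma IsCenteredSq.integrable_id {μ : Measure H} (hμ : IsCenteredSq μ) :
    Integrable (fun x => x) μ := by
  have := hμ.prob
  exact hμ.memLp.integrable (by norm_num)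

lemma IsCenteredSq.integrable_sq {μ : Measure H} (hμ : IsCenteredSq μ) (A : H →L[ℝ] H) :
    Integrable (fun x => ‖A x‖ ^ 2) μ :=
  (memLp_two_iff_integrable_sq_norm (by fun_prop)).1 (A.comp_memLp' hμ.memLp)

lemma memLp_id_conv {μ ν : Measure H} [IsProbabilityMeasure μ] [IsProbabilityMeasure ν]
    (hμ : MemLp id 2 μ) (hν : MemLp id 2 ν) : MemLp id 2 (μ ∗ ν) := by
  rw [Measure.conv, memLp_map_measure_iff (by fun_prop) (by fun_prop)]
  exact (hμ.comp_fst ν).add (hν.comp_snd μ)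

lemma memLp_id_right_of_conv {μ ν : Measure H} [IsProbabilityMeasure μ] [IsProbabilityMeasure ν]
    (h : MemLp id 2 (μ ∗ ν)) : MemLp id 2 ν := by
  have h1 := (memLp_two_iff_integrable_sq_norm (by fun_prop)).1 h
  obtain ⟨x, hx⟩ := ((integrable_conv_iff (by fun_prop)).1 h1).1.exists
  have h2 : MemLp (fun y : H => x + y) 2 ν :=
    (memLp_two_iff_integrable_sq_norm (by fun_prop)).2 hx
  convert! h2.sub (memLp_const x) using 1
  ext y
  simp

lemma integral_id_conv {μ ν : Measure H} [IsProbabilityMeasure μ] [IsProbabilityMeasure ν]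
    (hμ : MemLp id 2 μ) (hν : MemLp id 2 ν) :
    ∫ x, x ∂(μ ∗ ν) = ∫ x, x ∂μ + ∫ x, x ∂ν := by
  have h1 : Integrable (fun x : H => x) μ := hμ.integrable (by norm_num)
  have h2 : Integrable (fun x : H => x) ν := hν.integrable (by norm_num)
  have h3 : Integrable (fun x : H => x) (μ ∗ ν) :=
    (memLp_id_conv hμ hν).integrable (by norm_num)
  rw [integral_conv h3]
  have : ∀ x : H, ∫ y, x + y ∂ν = x + ∫ y, y ∂ν := fun x => by
    rw [integral_add (integrable_const _) h2]; simp
  simp_rw [this]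
  rw [integral_add h1 (integrable_const _)]
  simp

lemma IsCenteredSq.conv {μ ν : Measure H} (hμ : IsCenteredSq μ) (hν : IsCenteredSq ν) :
    IsCenteredSq (μ ∗ ν) := by
  have := hμ.prob
  have := hν.prob
  refine ⟨inferInstance, memLp_id_conv hμ.memLp hν.memLp, ?_⟩
  rw [integral_id_conv hμ.memLp hν.memLp, hμ.mean, hν.mean, add_zero]

lemma IsCenteredSq.integral_sq_conv {μ ν : Measure H} (hμ : IsCenteredSq μ)
    (hν : IsCenteredSq ν) (A : H →L[ℝ] H) :
    ∫ x, ‖A x‖ ^ 2 ∂(μ ∗ ν) = ∫ x, ‖A x‖ ^ 2 ∂μ + ∫ x, ‖A x‖ ^ 2 ∂ν := by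
  have := hμ.prob
  have := hν.prob
  rw [integral_conv ((hμ.conv hν).integrable_sq A)]
  have hA : Integrable (fun y => A y) ν := A.integrable_comp hν.integrable_id
  have : ∀ x : H, ∫ y, ‖A (x + y)‖ ^ 2 ∂ν = ‖A x‖ ^ 2 + ∫ y, ‖A y‖ ^ 2 ∂ν := fun x => by
    have h1 : ∀ y, ‖A (x + y)‖ ^ 2 = ‖A x‖ ^ 2 + 2 * ⟪A x, A y⟫_ℝ + ‖A y‖ ^ 2 := fun y => by
      rw [map_add, norm_add_sq_real]
    have h2 : Integrable (fun y => ⟪A x, A y⟫_ℝ) ν := hA.const_inner _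
    simp_rw [h1]
    have h3 : Integrable (fun y => ‖A x‖ ^ 2 + 2 * ⟪A x, A y⟫_ℝ) ν :=
      (integrable_const _).add (h2.const_mul 2)
    rw [integral_add h3 (hν.integrable_sq A), integral_add (integrable_const _) (h2.const_mul 2),
      integral_const_mul, integral_inner hA, A.integral_comp_comm hν.integrable_id, hν.mean]
    simp
  simp_rw [this]
  rw [integral_add (hμ.integrable_sq A) (integrable_const _)]
  simp

lemma IsCenteredSq.map {μ : Measure H} (hμ : IsCenteredSq μ) (A : H →L[ℝ] H) :
    IsCenteredSq (μ.map A) := by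
  have := hμ.prob
  refine ⟨Measure.isProbabilityMeasure_map (by fun_prop), ?_, ?_⟩
  · rw [memLp_map_measure_iff (by fun_prop) (by fun_prop)]
    exact A.comp_memLp' hμ.memLp
  · rw [integral_map (by fun_prop) (by fun_prop), A.integral_comp_comm hμ.integrable_id, hμ.mean,
      map_zero]

lemma isCenteredSq_dirac_zero : IsCenteredSq (Measure.dirac (0 : H)) :=
  ⟨inferInstance, (memLp_two_iff_integrable_sq_norm (by fun_prop)).2
    (integrable_dirac (by simp)), by simp⟩

lemma isProbabilityMeasure_convPow {ν : Measure H} [IsProbabilityMeasure ν] (n : ℕ) :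
    IsProbabilityMeasure (convPow ν n) := by
  induction n with
  | zero => exact Measure.dirac.isProbabilityMeasure
  | succ n ih => exact inferInstanceAs (IsProbabilityMeasure (convPow ν n ∗ ν))

lemma memLp_id_convPow {ν : Measure H} [IsProbabilityMeasure ν] (hν : MemLp id 2 ν) (n : ℕ) :
    MemLp id 2 (convPow ν n) ∧ ∫ x, x ∂(convPow ν n) = n • ∫ x, x ∂ν := by
  induction n with
  | zero => exact ⟨isCenteredSq_dirac_zero.memLp, by simp [convPow]⟩
  | succ n ih =>
    have := isProbabilityMeasure_convPow (ν := ν) n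
    refine ⟨memLp_id_conv ih.1 hν, ?_⟩
    rw [succ_nsmul, ← ih.2]
    exact integral_id_conv ih.1 hν

lemma IsCenteredSq.of_convPow {ν : Measure H} [IsProbabilityMeasure ν] {n : ℕ} (hn : n ≠ 0)
    (h : IsCenteredSq (convPow ν n)) : IsCenteredSq ν := by
  obtain ⟨m, rfl⟩ := Nat.exists_eq_succ_of_ne_zero hn
  have := isProbabilityMeasure_convPow (ν := ν) m
  have hν : MemLp id 2 ν := memLp_id_right_of_conv (μ := convPow ν m) h.memLp
  refine ⟨inferInstance, hν, ?_⟩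
  have := (memLp_id_convPow hν m.succ).2
  rw [h.mean, eq_comm, ← Nat.cast_smul_eq_nsmul ℝ, smul_eq_zero] at this
  exact this.resolve_left (by positivity)

lemma IsCenteredSq.convPow {ν : Measure H} (hν : IsCenteredSq ν) (A : H →L[ℝ] H) (n : ℕ) :
    IsCenteredSq (convPow ν n) ∧ ∫ x, ‖A x‖ ^ 2 ∂(convPow ν n) = n * ∫ x, ‖A x‖ ^ 2 ∂ν := by
  induction n with
  | zero => exact ⟨isCenteredSq_dirac_zero, by simp [_root_.convPow]⟩
  | succ n ih =>
    refine ⟨ih.1.conv hν, ?_⟩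
    rw [Nat.cast_succ, add_mul, one_mul, ← ih.2]
    exact ih.1.integral_sq_conv hν A

lemma charFun_convPow {ν : Measure H} [IsProbabilityMeasure ν] (n : ℕ) (a : H) :
    charFun (convPow ν n) a = charFun ν a ^ n := by
  induction n with
  | zero => simp [convPow, charFun_dirac]
  | succ n ih =>
    have := isProbabilityMeasure_convPow (ν := ν) n
    rw [pow_succ, ← ih]
    exact charFun_conv a

lemma charFun_map_continuousLinearMap {μ : Measure H} (A : H →L[ℝ] H) (a : H) :
    charFun (μ.map A) a = charFun μ (ContinuousLinearMap.adjoint A a) := by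
  rw [charFun_apply, charFun_apply, integral_map (by fun_prop) (by fun_prop)]
  simp_rw [ContinuousLinearMap.adjoint_inner_right]

end CenteredMoments

section Exponent

open Topology
open scoped Convolution

set_option linter.unusedSectionVars false

variable {H : Type*} [NormedAddCommGroup H] [InnerProductSpace ℝ H] [CompleteSpace H]
  [MeasurableSpace H] [BorelSpace H] [SecondCountableTopology H]

lemma norm_exp_mul_I_sub_le (r : ℝ) :
    ‖Complex.exp (r * Complex.I) - 1 - r * Complex.I‖ ≤ 3 * r ^ 2 := by
  have hr : ‖(r : ℂ) * Complex.I‖ = |r| := by simp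
  rcases le_total |r| 1 with h | h
  · have := Complex.norm_exp_sub_one_sub_id_le (hr.trans_le h)
    rw [hr, sq_abs] at this
    nlinarith [sq_nonneg r]
  · have h1 : ‖Complex.exp (r * Complex.I)‖ = 1 := Complex.norm_exp_ofReal_mul_I r
    calc _ ≤ ‖Complex.exp (r * Complex.I)‖ + ‖(1 : ℂ)‖ + ‖(r : ℂ) * Complex.I‖ :=
          (norm_sub_le _ _).trans (add_le_add_left (norm_sub_le _ _) _)
      _ = 2 + |r| := by rw [h1, hr, norm_one]; norm_num
      _ ≤ 3 * r ^ 2 := by rw [← sq_abs]; nlinarith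

lemma IsCenteredSq.norm_charFun_sub_one_le {μ : Measure H} (hμ : IsCenteredSq μ) (a : H) :
    ‖charFun μ a - 1‖ ≤ 3 * ‖a‖ ^ 2 * ∫ x, ‖x‖ ^ 2 ∂μ := by
  have := hμ.prob
  have hexp : Integrable (fun x => Complex.exp (⟪x, a⟫_ℝ * Complex.I)) μ :=
    Integrable.of_bound (by fun_prop) 1
      (ae_of_all _ fun x => (Complex.norm_exp_ofReal_mul_I _).le)
  have hin : Integrable (fun x => ⟪x, a⟫_ℝ) μ := hμ.integrable_id.inner_const a
  have hz : ∫ x, (⟪x, a⟫_ℝ * Complex.I : ℂ) ∂μ = 0 := by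
    rw [integral_mul_const, integral_complex_ofReal]
    simp_rw [real_inner_comm a]
    rw [integral_inner hμ.integrable_id, hμ.mean]
    simp
  have hI : Integrable (fun x => (⟪x, a⟫_ℝ * Complex.I : ℂ)) μ := hin.ofReal.mul_const _
  have h1 : Integrable (fun x => Complex.exp (⟪x, a⟫_ℝ * Complex.I) - 1) μ :=
    hexp.sub (integrable_const 1)
  have h2 : charFun μ a - 1
      = ∫ x, (Complex.exp (⟪x, a⟫_ℝ * Complex.I) - 1 - ⟪x, a⟫_ℝ * Complex.I) ∂μ := by
    rw [integral_sub h1 hI, hz, integral_sub hexp (integrable_const 1), charFun_apply]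
    simp
  rw [h2, ← integral_const_mul]
  refine norm_integral_le_of_norm_le ((hμ.integrable_sq (.id ℝ H)).const_mul _)
    (ae_of_all _ fun x => (norm_exp_mul_I_sub_le _).trans ?_)
  have := abs_real_inner_le_norm x a
  have h3 : ⟪x, a⟫_ℝ ^ 2 ≤ (‖x‖ * ‖a‖) ^ 2 := sq_le_sq' (abs_le.1 this).1 (abs_le.1 this).2
  nlinarith

lemma norm_le_of_norm_exp_div_sub_one_le {z : ℂ} {C : ℝ}
    (h : ∀ n : ℕ, n ≠ 0 → ‖Complex.exp (z / n) - 1‖ ≤ C / n) : ‖z‖ ≤ C := by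
  have h1 : ∀ᶠ n : ℕ in atTop, ‖z‖ ≤ C + ‖z‖ ^ 2 / n := by
    filter_upwards [eventually_ge_atTop (⌈‖z‖⌉₊ + 1)] with n hn
    have hn0 : n ≠ 0 := by omega
    have hnpos : (0 : ℝ) < n := by positivity
    have hzn : ‖z‖ ≤ n := (Nat.le_ceil _).trans (by exact_mod_cast (by omega))
    have hz : ‖z / n‖ = ‖z‖ / n := by simp
    have h2 := Complex.norm_exp_sub_one_sub_id_le (x := z / n)
      (by rw [hz]; exact (div_le_one hnpos).2 hzn)
    have h3 : ‖z / n‖ ≤ C / n + (‖z‖ / n) ^ 2 := by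
      rw [hz] at h2
      calc ‖z / n‖ = ‖(Complex.exp (z / n) - 1) - (Complex.exp (z / n) - 1 - z / n)‖ := by
            congr 1; ring
        _ ≤ _ := (norm_sub_le _ _).trans (add_le_add (h n hn0) h2)
    rw [hz] at h3
    have h4 := mul_le_mul_of_nonneg_right h3 hnpos.le
    have h5 : (C / n + (‖z‖ / n) ^ 2) * n = C + ‖z‖ ^ 2 / n := by field_simp
    rwa [div_mul_cancel₀ _ hnpos.ne', h5] at h4
  have h2 : Tendsto (fun n : ℕ => C + ‖z‖ ^ 2 / n) atTop (𝓝 (C + 0)) :=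
    tendsto_const_nhds.add (tendsto_const_div_atTop_nhds_zero_nat _)
  rw [add_zero] at h2
  exact ge_of_tendsto h2 h1

lemma charFun_eq_exp_div {ν : Measure H} [IsProbabilityMeasure ν] {L : H → ℂ}
    (hL : Continuous L) (hL0 : L 0 = 0) {n : ℕ} (hn : n ≠ 0)
    (h : ∀ a, charFun ν a ^ n = Complex.exp (L a)) (a : H) :
    charFun ν a = Complex.exp (L a / n) := by
  have hn' : (n : ℂ) ≠ 0 := by exact_mod_cast hn
  have hcont : Continuous (charFun ν) := continuous_charFun
  let g : H → ℂ := fun a => charFun ν a * Complex.exp (-(L a / n))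
  have hg : Continuous g := by fun_prop
  have hgn : ∀ a, g a ^ n = 1 := fun a => by
    simp only [g]
    rw [mul_pow, h, ← Complex.exp_nat_mul, ← Complex.exp_add]
    rw [show L a + n * -(L a / n) = 0 by field_simp; ring, Complex.exp_zero]
  have hfin : {z : ℂ | z ^ n = 1}.Finite := by
    refine (Polynomial.nthRoots n (1 : ℂ)).toFinset.finite_toSet.subset fun z hz => ?_
    simpa [Polynomial.mem_nthRoots (Nat.pos_of_ne_zero hn)] using hz
  have h1 : g a = g 0 := isPreconnected_univ.constant_of_mapsTo hfin.isDiscrete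
    hg.continuousOn (fun x _ => hgn x) (Set.mem_univ _) (Set.mem_univ _)
  have h2 : g 0 = 1 := by simp [g, hL0, charFun_zero]
  have h3 : charFun ν a * Complex.exp (-(L a / n)) = 1 := h1.trans h2
  rw [Complex.exp_neg] at h3
  exact (mul_inv_eq_one₀ (Complex.exp_ne_zero _)).1 h3

/-- The convolution roots of a centered infinitely divisible measure, with their moments and
characteristic functionals. -/
lemma IsInfDiv.exists_root {ν₀ : Measure H} (hID : IsInfDiv ν₀) (hν₀ : IsCenteredSq ν₀) {L : H → ℂ}
    (hL : Continuous L) (hL0 : L 0 = 0) (hLexp : ∀ a, Complex.exp (L a) = charFn ν₀ a)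
    {n : ℕ} (hn : n ≠ 0) :
    ∃ ν : Measure H, IsCenteredSq ν ∧
      (∀ A : H →L[ℝ] H, ∫ x, ‖A x‖ ^ 2 ∂ν = (∫ x, ‖A x‖ ^ 2 ∂ν₀) / n) ∧
      ∀ a, charFun ν a = Complex.exp (L a / n) := by
  obtain ⟨ν, hν, rfl⟩ := hID n (Nat.one_le_iff_ne_zero.2 hn)
  have hc := hν₀.of_convPow hn
  refine ⟨ν, hc, fun A => ?_, charFun_eq_exp_div hL hL0 hn fun a => ?_⟩
  · rw [(hc.convPow A n).2]
    field_simp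
  · rw [hLexp, ← charFun_convPow]
    rfl

lemma norm_exponent_le {ν₀ : Measure H} (hID : IsInfDiv ν₀) (hν₀ : IsCenteredSq ν₀) {L : H → ℂ}
    (hL : Continuous L) (hL0 : L 0 = 0) (hLexp : ∀ a, Complex.exp (L a) = charFn ν₀ a) (a : H) :
    ‖L a‖ ≤ 3 * ‖a‖ ^ 2 * ∫ x, ‖x‖ ^ 2 ∂ν₀ := by
  refine norm_le_of_norm_exp_div_sub_one_le fun n hn => ?_
  obtain ⟨ν, hν, hm, hc⟩ := hID.exists_root hν₀ hL hL0 hLexp hn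
  rw [← hc, mul_div_assoc]
  have := hm (.id ℝ H)
  simp only [ContinuousLinearMap.coe_id', id_eq] at this
  rw [← this]
  exact hν.norm_charFun_sub_one_le a

end Exponent

section Semigroup

open Topology

set_option linter.unusedSectionVars false

variable {H : Type*} [NormedAddCommGroup H] [InnerProductSpace ℝ H] [CompleteSpace H]
  [MeasurableSpace H] [BorelSpace H] [SecondCountableTopology H]

lemma IsC0.continuous_max {T : ℝ → H →L[ℝ] H} (hT : IsC0 T) (x : H) :
    Continuous fun s => T (max s 0) x :=
  (hT.2.2 x).comp_continuous (by fun_prop) fun s => le_max_right s 0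

lemma IsC0.exists_norm_le {T : ℝ → H →L[ℝ] H} (hT : IsC0 T) (t : ℝ) :
    ∃ M : ℝ, 0 ≤ M ∧ ∀ s ∈ Set.Icc 0 t, ‖T s‖ ≤ M := by
  obtain ⟨M, hM⟩ := banach_steinhaus (g := fun s : Set.Icc 0 t => T s) fun x => by
    obtain ⟨C, hC⟩ := isCompact_Icc.exists_bound_of_continuousOn
      ((hT.2.2 x).mono fun s (hs : s ∈ Set.Icc 0 t) => hs.1)
    exact ⟨C, fun s => hC s s.2⟩
  exact ⟨max M 0, le_max_right _ _, fun s hs => (hM ⟨s, hs⟩).trans (le_max_left _ _)⟩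

lemma IsC0.continuous_charFun_adjoint {T : ℝ → H →L[ℝ] H} (hT : IsC0 T) (ν : Measure H)
    [IsFiniteMeasure ν] (a : H) :
    Continuous fun s => charFun ν (ContinuousLinearMap.adjoint (T (max s 0)) a) := by
  simp_rw [charFun_apply, ContinuousLinearMap.adjoint_inner_right]
  refine continuous_of_dominated (bound := fun _ => 1) (fun x => by fun_prop)
    (fun x => ae_of_all _ fun y => (Complex.norm_exp_ofReal_mul_I _).le) (integrable_const _)
    (ae_of_all _ fun y => ?_)
  exact Complex.continuous_exp.comp ((Complex.continuous_ofReal.comp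
    ((hT.continuous_max y).inner continuous_const)).mul continuous_const)

/-- The exponent is continuous along the orbits of the adjoint semigroup. -/
lemma continuous_exponent_adjoint {T : ℝ → H →L[ℝ] H} (hT : IsC0 T) {ν₀ : Measure H}
    (hID : IsInfDiv ν₀) (hν₀ : IsCenteredSq ν₀) {L : H → ℂ}
    (hL : Continuous L) (hL0 : L 0 = 0) (hLexp : ∀ a, Complex.exp (L a) = charFn ν₀ a) (a : H) :
    Continuous fun s => L (ContinuousLinearMap.adjoint (T (max s 0)) a) := by
  refine continuous_iff_continuousAt.2 fun s₀ => ?_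
  obtain ⟨M, hM0, hM⟩ := hT.exists_norm_le (max (s₀ + 1) 0)
  have hb : ∀ s < s₀ + 1, ‖L (ContinuousLinearMap.adjoint (T (max s 0)) a)‖
      ≤ 3 * (M * ‖a‖) ^ 2 * ∫ x, ‖x‖ ^ 2 ∂ν₀ := fun s hs => by
    refine (norm_exponent_le hID hν₀ hL hL0 hLexp _).trans ?_
    have h1 : ‖ContinuousLinearMap.adjoint (T (max s 0)) a‖ ≤ M * ‖a‖ := by
      refine (ContinuousLinearMap.le_opNorm _ _).trans ?_
      rw [LinearIsometryEquiv.norm_map]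
      exact mul_le_mul_of_nonneg_right
        (hM _ ⟨le_max_right _ _, max_le_max_right _ hs.le⟩) (norm_nonneg _)
    gcongr
  obtain ⟨n, hn⟩ := exists_nat_gt (3 * (M * ‖a‖) ^ 2 * ∫ x, ‖x‖ ^ 2 ∂ν₀)
  have hnpos : (0 : ℝ) < n := lt_of_le_of_lt (by positivity) hn
  have hn0 : n ≠ 0 := by exact_mod_cast hnpos.ne'
  have hnc : (n : ℂ) ≠ 0 := by exact_mod_cast hn0
  obtain ⟨ν, hν, -, hc⟩ := hID.exists_root hν₀ hL hL0 hLexp hn0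
  have := hν.prob
  have him : ∀ s < s₀ + 1,
      |(L (ContinuousLinearMap.adjoint (T (max s 0)) a) / n).im| < 1 := fun s hs =>
    (Complex.abs_im_le_norm _).trans_lt (by
      rw [norm_div, Complex.norm_natCast, div_lt_one hnpos]
      exact (hb s hs).trans_lt hn)
  have hlog : ∀ s < s₀ + 1, (n : ℂ) *
      Complex.log (charFun ν (ContinuousLinearMap.adjoint (T (max s 0)) a))
        = L (ContinuousLinearMap.adjoint (T (max s 0)) a) := fun s hs => by
    have h1 := abs_lt.1 (him s hs)
    have h2 := Real.pi_gt_three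
    rw [hc, Complex.log_exp (by linarith) (by linarith)]
    field_simp
  refine ContinuousAt.congr (f := fun s => (n : ℂ) *
      Complex.log (charFun ν (ContinuousLinearMap.adjoint (T (max s 0)) a))) ?_ ?_
  · refine continuousAt_const.mul
      ((hT.continuous_charFun_adjoint ν a).continuousAt.clog (Or.inl ?_))
    rw [hc, Complex.exp_re]
    have h1 := abs_lt.1 (him s₀ (by linarith))
    have h2 := Real.pi_gt_three
    exact mul_pos (Real.exp_pos _) (Real.cos_pos_of_mem_Ioo ⟨by linarith, by linarith⟩)
  · filter_upwards [Iio_mem_nhds (show s₀ < s₀ + 1 by linarith)] with s hs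
    exact hlog s hs

end Semigroup

section RiemannSum

open Topology

lemma norm_integral_sub_riemann_sum_le {f : ℝ → ℂ} (hf : Continuous f) {h ε : ℝ} (hh : 0 ≤ h)
    (N : ℕ) (hε : ∀ k < N, ∀ s ∈ Set.Icc (k * h) ((k + 1) * h), ‖f s - f (k * h)‖ ≤ ε) :
    ‖(∫ s in (0 : ℝ)..N * h, f s) - ∑ k ∈ Finset.range N, (h : ℂ) * f (k * h)‖ ≤ N * h * ε := by
  have h1 := intervalIntegral.sum_integral_adjacent_intervals (f := f) (μ := volume)
    (a := fun k : ℕ => k * h) (n := N) fun k _ => hf.intervalIntegrable _ _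
  simp only [Nat.cast_zero, zero_mul] at h1
  rw [← h1, ← Finset.sum_sub_distrib]
  refine (norm_sum_le_of_le _ (f := fun k : ℕ => (∫ s in (k * h)..((k + 1 : ℕ) * h), f s)
    - (h : ℂ) * f (k * h)) (n := fun _ => h * ε) fun k hk => ?_).trans (by simp [mul_assoc])
  have hle : k * h ≤ (k + 1 : ℕ) * h := by push_cast; nlinarith
  have h2 : (h : ℂ) * f (k * h) = ∫ _ in (k * h)..((k + 1 : ℕ) * h), f (k * h) := by
    rw [intervalIntegral.integral_const, Complex.real_smul]
    push_cast
    ring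
  rw [h2, ← intervalIntegral.integral_sub (hf.intervalIntegrable _ _) (by simp)]
  refine (intervalIntegral.norm_integral_le_of_norm_le_const (C := ε) fun s hs => ?_).trans
    (le_of_eq ?_)
  · rw [Set.uIoc_of_le hle] at hs
    exact hε k (Finset.mem_range.1 hk) s ⟨hs.1.le, by simpa using hs.2⟩
  · push_cast
    rw [show ((k : ℝ) + 1) * h - k * h = h by ring, abs_of_nonneg hh, mul_comm]

lemma tendsto_riemann_sum {f : ℝ → ℂ} (hf : Continuous f) {t : ℝ} (ht : 0 ≤ t) :
    Tendsto (fun n : ℕ => ∑ k ∈ Finset.range ⌊t * (n + 1)⌋₊,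
      (((n + 1 : ℝ)⁻¹ : ℝ) : ℂ) * f (k * (n + 1 : ℝ)⁻¹)) atTop (𝓝 (∫ s in (0 : ℝ)..t, f s)) := by
  have hinv : Tendsto (fun n : ℕ => (n + 1 : ℝ)⁻¹) atTop (𝓝 0) := by
    simpa using tendsto_one_div_add_atTop_nhds_zero_nat (𝕜 := ℝ)
  have hle : ∀ n : ℕ, (⌊t * (n + 1)⌋₊ : ℝ) * (n + 1 : ℝ)⁻¹ ≤ t := fun n => by
    rw [← div_eq_mul_inv, div_le_iff₀ (by positivity)]
    exact Nat.floor_le (by positivity)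
  have hfl : Tendsto (fun n : ℕ => (⌊t * (n + 1)⌋₊ : ℝ) * (n + 1 : ℝ)⁻¹) atTop (𝓝 t) := by
    have h1 : Tendsto (fun n : ℕ => t - (n + 1 : ℝ)⁻¹) atTop (𝓝 (t - 0)) :=
      tendsto_const_nhds.sub hinv
    rw [sub_zero] at h1
    refine tendsto_of_tendsto_of_tendsto_of_le_of_le h1 tendsto_const_nhds (fun n => ?_) hle
    have h2 : (0 : ℝ) < n + 1 := by positivity
    have h3 := Nat.lt_floor_add_one (t * (n + 1 : ℝ))
    simp only
    rw [← mul_le_mul_iff_left₀ h2, sub_mul, inv_mul_cancel₀ h2.ne', mul_assoc,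
      inv_mul_cancel₀ h2.ne']
    linarith
  have h_int : Tendsto (fun n : ℕ => ∫ s in (0 : ℝ)..⌊t * (n + 1)⌋₊ * (n + 1 : ℝ)⁻¹, f s) atTop
      (𝓝 (∫ s in (0 : ℝ)..t, f s)) :=
    ((intervalIntegral.continuous_primitive (fun a b => hf.intervalIntegrable a b) 0).tendsto
      t).comp hfl
  refine tendsto_of_tendsto_of_dist h_int (Metric.tendsto_atTop.2 fun ε hε => ?_)
  have huc := (isCompact_Icc (a := (0 : ℝ)) (b := t)).uniformContinuousOn_of_continuous
    hf.continuousOn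
  obtain ⟨δ, hδ, hδf⟩ := Metric.uniformContinuousOn_iff_le.1 huc (ε / (t + 1)) (by positivity)
  obtain ⟨n₀, hn₀⟩ := (hinv.eventually (gt_mem_nhds hδ)).exists_forall_of_atTop
  refine ⟨n₀, fun n hn => ?_⟩
  have hn' := hn₀ n hn
  set h : ℝ := (n + 1 : ℝ)⁻¹ with hh
  have hpos : 0 < h := by positivity
  have h1 := norm_integral_sub_riemann_sum_le hf (h := h) (ε := ε / (t + 1)) hpos.le
    ⌊t * (n + 1)⌋₊ fun k hk s hs => by
      have hk1 : ((k : ℝ) + 1) * h ≤ t := by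
        refine le_trans (mul_le_mul_of_nonneg_right ?_ hpos.le) (hle n)
        exact_mod_cast hk
      have hk0 : 0 ≤ k * h := by positivity
      rw [← dist_eq_norm]
      refine hδf s ⟨hk0.trans hs.1, hs.2.trans hk1⟩ (k * h) ⟨hk0, by linarith⟩ ?_
      rw [Real.dist_eq, abs_of_nonneg (by linarith [hs.1])]
      linarith [hs.2]
  rw [Real.dist_eq, sub_zero, abs_of_nonneg dist_nonneg, dist_eq_norm]
  refine lt_of_le_of_lt h1 ?_
  calc _ ≤ t * (ε / (t + 1)) := mul_le_mul_of_nonneg_right (hle n) (by positivity)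
    _ < ε := by rw [← mul_div_assoc, div_lt_iff₀ (by positivity)]; nlinarith

end RiemannSum

section Tightness

open Topology

set_option linter.unusedSectionVars false

variable {H : Type*} [NormedAddCommGroup H] [InnerProductSpace ℝ H] [CompleteSpace H]
  [MeasurableSpace H] [BorelSpace H] [SecondCountableTopology H]

lemma IsCenteredSq.measure_lt_norm_le {μ : Measure H} (hμ : IsCenteredSq μ) (A : H →L[ℝ] H)
    {r : ℝ} (hr : 0 < r) {δ : ℝ≥0} (h : ∫ x, ‖A x‖ ^ 2 ∂μ ≤ r ^ 2 * δ) :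
    μ {x | r < ‖A x‖} ≤ δ := by
  have := hμ.prob
  have h1 := mul_meas_ge_le_integral_of_nonneg (ae_of_all _ fun x => sq_nonneg ‖A x‖)
    (hμ.integrable_sq A) (r ^ 2)
  have h2 : μ.real {x | r ^ 2 ≤ ‖A x‖ ^ 2} ≤ δ :=
    le_of_mul_le_mul_left (h1.trans h) (by positivity)
  have h3 : {x | r < ‖A x‖} ⊆ {x | r ^ 2 ≤ ‖A x‖ ^ 2} := fun x (hx : r < ‖A x‖) =>
    pow_le_pow_left₀ hr.le hx.le 2
  refine (measure_mono h3).trans ?_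
  rw [← ENNReal.ofReal_coe_nnreal]
  exact (ENNReal.le_ofReal_iff_toReal_le (measure_ne_top _ _) δ.2).2 h2

/-- Sets that are bounded and uniformly close to finite-dimensional subspaces are compact. -/
lemma isCompact_closedBall_inter_near_subspaces (V : ℕ → Submodule ℝ H)
    [∀ k, FiniteDimensional ℝ (V k)] (R : ℝ) :
    IsCompact (Metric.closedBall (0 : H) R ∩
      ⋂ k : ℕ, {x | ‖x - (V k).starProjection x‖ ≤ 1 / ((k : ℝ) + 1)}) := by
  refine TotallyBounded.isCompact_of_isClosed (Metric.totallyBounded_iff.2 fun ε hε => ?_)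
    (Metric.isClosed_closedBall.inter (isClosed_iInter fun k =>
      isClosed_le (by fun_prop) continuous_const))
  obtain ⟨k, hk⟩ := exists_nat_one_div_lt (half_pos hε)
  have hC : IsCompact ((Subtype.val : V k → H) '' Metric.closedBall 0 R) :=
    (isCompact_closedBall _ _).image continuous_subtype_val
  obtain ⟨s, hs, hsub⟩ := Metric.totallyBounded_iff.1 hC.totallyBounded _ (half_pos hε)
  refine ⟨s, hs, fun x hx => ?_⟩
  have hxR : ‖x‖ ≤ R := by simpa using hx.1
  have hxk : ‖x - (V k).starProjection x‖ ≤ 1 / ((k : ℝ) + 1) := Set.mem_iInter.1 hx.2 k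
  have hmem : (V k).starProjection x ∈ (Subtype.val : V k → H) '' Metric.closedBall 0 R := by
    refine ⟨(V k).orthogonalProjectionOnto x, ?_, rfl⟩
    simpa using ((V k).norm_orthogonalProjectionOnto_apply_le x).trans hxR
  obtain ⟨y, hy, hyx⟩ := Set.mem_iUnion₂.1 (hsub hmem)
  refine Set.mem_iUnion₂.2 ⟨y, hy, ?_⟩
  rw [Metric.mem_ball] at hyx ⊢
  calc dist x y ≤ dist x ((V k).starProjection x) + dist ((V k).starProjection x) y :=
        dist_triangle _ _ _
    _ < ε / 2 + ε / 2 := add_lt_add (by rw [dist_eq_norm]; exact hxk.trans_lt hk) hyx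
    _ = ε := add_halves ε

/-- A second moment criterion for tightness in a separable Hilbert space. -/
lemma isTightMeasureSet_of_integral_sq_le (U : ℕ → Submodule ℝ H)
    [∀ k, FiniteDimensional ℝ (U k)] {S : Set (Measure H)} (hS : ∀ μ ∈ S, IsCenteredSq μ)
    {C : ℝ} (hC : ∀ μ ∈ S, ∫ x, ‖x‖ ^ 2 ∂μ ≤ C)
    (hU : ∀ ε : ℝ, 0 < ε → ∃ J, ∀ μ ∈ S, ∫ x, ‖x - (U J).starProjection x‖ ^ 2 ∂μ ≤ ε) :
    IsTightMeasureSet S := by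
  refine isTightMeasureSet_iff_exists_isCompact_measure_compl_le.2 fun ε hε => ?_
  obtain ⟨δ, hδ, hδε⟩ := ENNReal.exists_pos_sum_of_countable (ENNReal.half_pos hε.ne').ne' ℕ
  obtain ⟨η, hη0, hη⟩ := ENNReal.lt_iff_exists_nnreal_btwn.1 (ENNReal.half_pos hε.ne')
  have hη0' : (0 : ℝ) < η := by exact_mod_cast hη0
  choose J hJ using fun k : ℕ => hU ((1 / ((k : ℝ) + 1)) ^ 2 * δ k)
    (mul_pos (by positivity) (hδ k))
  obtain ⟨R, hR1, hR⟩ : ∃ R : ℝ, 0 < R ∧ C ≤ R ^ 2 * η := by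
    refine ⟨|C| / η + 1, by positivity, ?_⟩
    have h1 : 0 ≤ |C| / η := by positivity
    have h2 : |C| / η * η = |C| := div_mul_cancel₀ _ hη0'.ne'
    nlinarith [le_abs_self C, mul_nonneg h1 h1]
  refine ⟨_, isCompact_closedBall_inter_near_subspaces (fun k => U (J k)) R, fun μ hμ => ?_⟩
  have hsub : (Metric.closedBall (0 : H) R ∩
      ⋂ k : ℕ, {x | ‖x - (U (J k)).starProjection x‖ ≤ 1 / ((k : ℝ) + 1)})ᶜ ⊆
      {x | R < ‖ContinuousLinearMap.id ℝ H x‖} ∪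
        ⋃ k : ℕ, {x | 1 / ((k : ℝ) + 1) <
          ‖(ContinuousLinearMap.id ℝ H - (U (J k)).starProjection) x‖} := by
    intro x hx
    by_contra hcon
    simp only [Set.mem_union, Set.mem_iUnion, Set.mem_ofPred_eq, not_or, not_exists, not_lt]
      at hcon
    exact hx ⟨by simpa using hcon.1, Set.mem_iInter.2 hcon.2⟩
  calc _ ≤ _ := measure_mono hsub
    _ ≤ _ := measure_union_le _ _
    _ ≤ η + ∑' k, (δ k : ℝ≥0∞) := by
        refine add_le_add ((hS μ hμ).measure_lt_norm_le _ hR1 ((hC μ hμ).trans hR)) ?_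
        refine (measure_iUnion_le _).trans (ENNReal.tsum_le_tsum fun k => ?_)
        exact (hS μ hμ).measure_lt_norm_le _ (by positivity) (hJ k μ hμ)
    _ ≤ ε / 2 + ε / 2 := add_le_add hη.le hδε.le
    _ = ε := ENNReal.add_halves ε

/-- A separable Hilbert space is exhausted by an increasing sequence of finite-dimensional
subspaces. -/
lemma exists_monotone_finiteDimensional_dense (H : Type*) [NormedAddCommGroup H]
    [InnerProductSpace ℝ H] [SecondCountableTopology H] :
    ∃ U : ℕ → Submodule ℝ H, (∀ k, FiniteDimensional ℝ (U k)) ∧ Monotone U ∧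
      ⊤ ≤ (⨆ k, U k).topologicalClosure := by
  let d := TopologicalSpace.denseSeq H
  refine ⟨fun k => Submodule.span ℝ (d '' Set.Iio k), fun k =>
    FiniteDimensional.span_of_finite ℝ ((Set.finite_Iio k).image d), fun i j hij =>
    Submodule.span_mono (Set.image_mono (Set.Iio_subset_Iio hij)), ?_⟩
  have hd : Set.range d ⊆ (⨆ k, Submodule.span ℝ (d '' Set.Iio k) : Submodule ℝ H) := by
    rintro _ ⟨k, rfl⟩
    exact Submodule.mem_iSup_of_mem (k + 1)
      (Submodule.subset_span ⟨k, Nat.lt_succ_self k, rfl⟩)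
  intro x _
  exact closure_mono hd (TopologicalSpace.denseRange_denseSeq H x)

/-- Uniform approximation on orbits of a strongly continuous semigroup, in second mean. -/
lemma IsC0.exists_integral_sq_sub_starProjection_le {T : ℝ → H →L[ℝ] H} (hT : IsC0 T)
    {ν : Measure H} (hν : IsCenteredSq ν) {U : ℕ → Submodule ℝ H}
    [∀ k, FiniteDimensional ℝ (U k)] (hU : Monotone U) (hU' : ⊤ ≤ (⨆ k, U k).topologicalClosure)
    (t : ℝ) {ε : ℝ} (hε : 0 < ε) :
    ∃ J, ∀ s ∈ Set.Icc 0 t, ∫ x, ‖T s x - (U J).starProjection (T s x)‖ ^ 2 ∂ν ≤ ε := by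
  obtain ⟨M, hM0, hM⟩ := hT.exists_norm_le t
  have hcontr : ∀ J (y : H), ‖y - (U J).starProjection y‖ ≤ ‖y‖ := fun J y => by
    rw [← Submodule.starProjection_orthogonal_val]
    exact Submodule.norm_starProjection_apply_le _ y
  have hpt : ∀ x : H, Tendsto (fun q : ℕ × ℝ =>
      ‖T q.2 x - (U q.1).starProjection (T q.2 x)‖ ^ 2)
      (atTop ×ˢ 𝓟 (Set.Icc 0 t)) (𝓝 0) := fun x => by
    suffices h : Tendsto (fun q : ℕ × ℝ => ‖T q.2 x - (U q.1).starProjection (T q.2 x)‖)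
        (atTop ×ˢ 𝓟 (Set.Icc 0 t)) (𝓝 0) by simpa using h.pow 2
    have hcpt : IsCompact ((fun s => T s x) '' Set.Icc 0 t) :=
      isCompact_Icc.image_of_continuousOn ((hT.2.2 x).mono fun s hs => hs.1)
    refine Metric.tendsto_nhds.2 fun η hη => ?_
    obtain ⟨F, hF, hsub⟩ := Metric.totallyBounded_iff.1 hcpt.totallyBounded _ (half_pos hη)
    have hFev : ∀ᶠ J in atTop, ∀ y ∈ F, ‖y - (U J).starProjection y‖ < η / 2 := by
      refine (Filter.eventually_all_finite hF).2 fun y _ => ?_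
      have h1 : Tendsto (fun J => ‖y - (U J).starProjection y‖) atTop (𝓝 ‖y - y‖) :=
        (tendsto_const_nhds.sub (Submodule.starProjection_tendsto_self U hU y hU')).norm
      rw [sub_self, norm_zero] at h1
      exact h1.eventually (gt_mem_nhds (half_pos hη))
    rw [Filter.eventually_prod_principal_iff]
    filter_upwards [hFev] with J hJ s hs
    obtain ⟨y, hy, hyd⟩ := Set.mem_iUnion₂.1 (hsub ⟨s, hs, rfl⟩)
    rw [Metric.mem_ball, dist_eq_norm] at hyd
    rw [Real.dist_eq, sub_zero, abs_norm]
    calc ‖T s x - (U J).starProjection (T s x)‖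
        = ‖((T s x - y) - (U J).starProjection (T s x - y)) + (y - (U J).starProjection y)‖ := by
          rw [map_sub]; congr 1; abel
      _ ≤ _ := norm_add_le _ _
      _ < η / 2 + η / 2 := add_lt_add ((hcontr _ _).trans_lt hyd) (hJ y hy)
      _ = η := add_halves η
  have hlim : Tendsto (fun q : ℕ × ℝ => ∫ x, ‖T q.2 x - (U q.1).starProjection (T q.2 x)‖ ^ 2 ∂ν)
      (atTop ×ˢ 𝓟 (Set.Icc 0 t)) (𝓝 (∫ _, 0 ∂ν)) := by
    refine tendsto_integral_filter_of_dominated_convergence (fun x => M ^ 2 * ‖x‖ ^ 2)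
      (Eventually.of_forall fun q => by fun_prop) ?_
      ((hν.integrable_sq (.id ℝ H)).const_mul _) (ae_of_all _ hpt)
    rw [Filter.eventually_prod_principal_iff]
    refine Eventually.of_forall fun J s hs => ae_of_all _ fun x => ?_
    rw [Real.norm_of_nonneg (by positivity), ← mul_pow]
    exact pow_le_pow_left₀ (norm_nonneg _)
      ((hcontr _ _).trans ((T s).le_of_opNorm_le (hM s hs) x)) 2
  rw [integral_zero] at hlim
  have h1 := hlim.eventually (ge_mem_nhds hε)
  rw [Filter.eventually_prod_principal_iff] at h1
  exact h1.exists

end Tightness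

section Existence

set_option linter.unusedSectionVars false

open Topology
open scoped Convolution

variable {H : Type*} [NormedAddCommGroup H] [InnerProductSpace ℝ H] [CompleteSpace H]
  [MeasurableSpace H] [BorelSpace H] [SecondCountableTopology H]

/-- The convolution of the images of `ν` under `T (k * h)` for `k < N`. -/
def riemannConv (ν : Measure H) (T : ℝ → H →L[ℝ] H) (h : ℝ) : ℕ → Measure H
  | 0 => Measure.dirac 0
  | N + 1 => riemannConv ν T h N ∗ ν.map (T (N * h))

lemma IsCenteredSq.riemannConv {ν : Measure H} (hν : IsCenteredSq ν) (T : ℝ → H →L[ℝ] H) (h : ℝ)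
    (N : ℕ) : IsCenteredSq (riemannConv ν T h N) := by
  induction N with
  | zero => exact isCenteredSq_dirac_zero
  | succ N ih => exact ih.conv (hν.map _)

lemma IsCenteredSq.integral_sq_riemannConv {ν : Measure H} (hν : IsCenteredSq ν)
    (T : ℝ → H →L[ℝ] H) (h : ℝ) (A : H →L[ℝ] H) (N : ℕ) :
    ∫ x, ‖A x‖ ^ 2 ∂(_root_.riemannConv ν T h N)
      = ∑ k ∈ Finset.range N, ∫ x, ‖A (T (k * h) x)‖ ^ 2 ∂ν := by
  induction N with
  | zero => simp [_root_.riemannConv]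
  | succ N ih =>
    rw [Finset.sum_range_succ, ← ih, _root_.riemannConv,
      (hν.riemannConv T h N).integral_sq_conv (hν.map _) A,
      integral_map (by fun_prop) (by fun_prop)]

lemma IsCenteredSq.charFun_riemannConv {ν : Measure H} (hν : IsCenteredSq ν)
    (T : ℝ → H →L[ℝ] H) (h : ℝ) (a : H) (N : ℕ) :
    charFun (_root_.riemannConv ν T h N) a
      = ∏ k ∈ Finset.range N, charFun ν (ContinuousLinearMap.adjoint (T (k * h)) a) := by
  induction N with
  | zero => simp [_root_.riemannConv, charFun_dirac]
  | succ N ih =>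
    have := (hν.riemannConv T h N).prob
    have := (hν.map (T (N * h))).prob
    rw [Finset.prod_range_succ, ← ih, _root_.riemannConv, charFun_conv,
      charFun_map_continuousLinearMap]

lemma exists_subseq_tendsto_of_isTightMeasureSet {μ : ℕ → ProbabilityMeasure H}
    (h : IsTightMeasureSet (Set.range fun n => (μ n : Measure H))) :
    ∃ (ν : ProbabilityMeasure H) (φ : ℕ → ℕ), StrictMono φ ∧ Tendsto (μ ∘ φ) atTop (𝓝 ν) := by
  have h1 : IsCompact (closure (Set.range μ)) := by
    refine isCompact_closure_of_isTightMeasureSet ?_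
    convert h using 1
    ext m
    simp
  obtain ⟨ν, -, φ, hφ, hlim⟩ := h1.tendsto_subseq fun n => subset_closure (Set.mem_range_self n)
  exact ⟨ν, φ, hφ, hlim⟩

lemma tendsto_charFun_of_tendsto {ι : Type*} {l : Filter ι} {μ : ι → ProbabilityMeasure H}
    {ν : ProbabilityMeasure H} (h : Tendsto μ l (𝓝 ν)) (a : H) :
    Tendsto (fun i => charFun (μ i : Measure H) a) l (𝓝 (charFun (ν : Measure H) a)) := by
  simp_rw [charFun_eq_integral_innerProbChar]
  exact (ProbabilityMeasure.tendsto_iff_forall_integral_rclike_tendsto ℂ).1 h _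

lemma integral_Ioo_exponent_adjoint (T : ℝ → H →L[ℝ] H) (L : H → ℂ) (a : H) {t : ℝ}
    (ht : 0 ≤ t) :
    ∫ s in Set.Ioo 0 t, L (ContinuousLinearMap.adjoint (T s) a)
      = ∫ s in (0 : ℝ)..t, L (ContinuousLinearMap.adjoint (T (max s 0)) a) := by
  rw [intervalIntegral.integral_of_le ht, integral_Ioc_eq_integral_Ioo]
  refine setIntegral_congr_fun measurableSet_Ioo fun s hs => ?_
  simp only [max_eq_left hs.1.le]

lemma exists_probabilityMeasure_charFun_eq {T : ℝ → H →L[ℝ] H} (hT : IsC0 T) {ν₀ : Measure H}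
    (hID : IsInfDiv ν₀) (hν₀ : IsCenteredSq ν₀) {L : H → ℂ}
    (hL : Continuous L) (hL0 : L 0 = 0) (hLexp : ∀ a, Complex.exp (L a) = charFn ν₀ a) {t : ℝ}
    (ht : 0 ≤ t) :
    ∃ μ : Measure H, IsProbabilityMeasure μ ∧ ∀ a, charFun μ a = Complex.exp
      (∫ s in (0 : ℝ)..t, L (ContinuousLinearMap.adjoint (T (max s 0)) a)) := by
  choose ν hν hm hc using fun n : ℕ => hID.exists_root hν₀ hL hL0 hLexp n.succ_ne_zero
  set N : ℕ → ℕ := fun n => ⌊t * (n + 1)⌋₊ with hN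
  have hNle : ∀ n : ℕ, (N n : ℝ) ≤ t * (n + 1) := fun n => Nat.floor_le (by positivity)
  have hmem : ∀ n, ∀ k < N n, (k * (n + 1 : ℝ)⁻¹ : ℝ) ∈ Set.Icc 0 t := fun n k hk => by
    refine ⟨by positivity, ?_⟩
    rw [← div_eq_mul_inv, div_le_iff₀ (by positivity)]
    exact (Nat.cast_le.2 hk.le).trans (hNle n)
  set m : ℕ → Measure H := fun n => riemannConv (ν n) T (n + 1 : ℝ)⁻¹ (N n) with hmdef
  have hmc : ∀ n, IsCenteredSq (m n) := fun n => (hν n).riemannConv _ _ _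
  have hbound : ∀ (A : H →L[ℝ] H) (C : ℝ), 0 ≤ C →
      (∀ s ∈ Set.Icc 0 t, ∫ x, ‖A (T s x)‖ ^ 2 ∂ν₀ ≤ C) → ∀ n, ∫ x, ‖A x‖ ^ 2 ∂(m n) ≤ t * C := by
    intro A C hC0 hC n
    rw [hmdef, (hν n).integral_sq_riemannConv]
    calc _ ≤ ∑ k ∈ Finset.range (N n), C / (n + 1) := Finset.sum_le_sum fun k hk => by
          have := hm n (A.comp (T (k * (n + 1 : ℝ)⁻¹)))
          simp only [ContinuousLinearMap.comp_apply, Nat.succ_eq_add_one, Nat.cast_add,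
            Nat.cast_one] at this
          rw [this]
          gcongr
          exact hC _ (hmem n k (Finset.mem_range.1 hk))
      _ = N n * (C / (n + 1)) := by simp
      _ ≤ t * (n + 1) * (C / (n + 1)) := by gcongr; exact hNle n
      _ = t * C := by field_simp
  have htight : IsTightMeasureSet (Set.range m) := by
    obtain ⟨M, hM0, hM⟩ := hT.exists_norm_le t
    obtain ⟨U, hUfin, hU, hU'⟩ := exists_monotone_finiteDimensional_dense H
    refine isTightMeasureSet_of_integral_sq_le U (C := t * (M ^ 2 * ∫ x, ‖x‖ ^ 2 ∂ν₀)) ?_ ?_ ?_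
    · rintro _ ⟨n, rfl⟩
      exact hmc n
    · rintro _ ⟨n, rfl⟩
      refine hbound (.id ℝ H) _ (by positivity) (fun s hs => ?_) n
      rw [← integral_const_mul]
      refine integral_mono (hν₀.integrable_sq (T s))
        ((hν₀.integrable_sq (.id ℝ H)).const_mul _) fun x => ?_
      simp only [ContinuousLinearMap.coe_id', id_eq]
      rw [← mul_pow]
      gcongr
      exact (T s).le_of_opNorm_le (hM s hs) x
    · intro ε hε
      obtain ⟨J, hJ⟩ := hT.exists_integral_sq_sub_starProjection_le hν₀ hU hU' t
        (ε := ε / (t + 1)) (by positivity)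
      refine ⟨J, ?_⟩
      rintro _ ⟨n, rfl⟩
      refine (hbound (.id ℝ H - (U J).starProjection) _ (by positivity) hJ n).trans ?_
      rw [← mul_div_assoc, div_le_iff₀ (by positivity)]
      nlinarith
  obtain ⟨μ, φ, hφ, hlim⟩ := exists_subseq_tendsto_of_isTightMeasureSet
    (μ := fun n => (⟨m n, (hmc n).prob⟩ : ProbabilityMeasure H)) htight
  refine ⟨μ, inferInstance, fun a => ?_⟩
  refine tendsto_nhds_unique (tendsto_charFun_of_tendsto hlim a) ?_
  have hsum := (tendsto_riemann_sum
    (continuous_exponent_adjoint hT hID hν₀ hL hL0 hLexp a) ht).cexp.comp hφ.tendsto_atTop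
  refine hsum.congr fun i => ?_
  change _ = charFun (riemannConv (ν (φ i)) T _ (N (φ i))) a
  rw [Function.comp_apply, (hν _).charFun_riemannConv, Complex.exp_sum]
  refine Finset.prod_congr rfl fun k _ => ?_
  rw [hc, max_eq_left (by positivity)]
  congr 1
  push_cast
  field_simp

end Existence

section Properties

set_option linter.unusedSectionVars false

open Topology
open scoped Convolution

variable {H : Type*} [NormedAddCommGroup H] [InnerProductSpace ℝ H] [CompleteSpace H]
  [MeasurableSpace H] [BorelSpace H] [SecondCountableTopology H]

lemma IsC0.integral_add_eq {T : ℝ → H →L[ℝ] H} (hT : IsC0 T) {L : H → ℂ}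
    (hL : ∀ a, Continuous fun s => L (ContinuousLinearMap.adjoint (T (max s 0)) a)) (a : H)
    {r t : ℝ} (hr : 0 ≤ r) (ht : 0 ≤ t) :
    ∫ s in (0 : ℝ)..(r + t), L (ContinuousLinearMap.adjoint (T (max s 0)) a)
      = (∫ s in (0 : ℝ)..r, L (ContinuousLinearMap.adjoint (T (max s 0))
          (ContinuousLinearMap.adjoint (T t) a)))
        + ∫ s in (0 : ℝ)..t, L (ContinuousLinearMap.adjoint (T (max s 0)) a) := by
  rw [← intervalIntegral.integral_add_adjacent_intervals (b := t)
    ((hL a).intervalIntegrable _ _) ((hL a).intervalIntegrable _ _), add_comm]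
  congr 1
  have h := intervalIntegral.integral_comp_add_right (a := 0) (b := r)
    (fun s => L (ContinuousLinearMap.adjoint (T (max s 0)) a)) t
  rw [zero_add] at h
  rw [← h]
  refine intervalIntegral.integral_congr fun s hs => ?_
  rw [Set.uIcc_of_le hr] at hs
  simp only [max_eq_left hs.1, max_eq_left (add_nonneg hs.1 ht)]
  rw [add_comm s t, hT.2.1 t s ht hs.1, ContinuousLinearMap.adjoint_comp,
    ContinuousLinearMap.comp_apply]

/-- A probability measure with characteristic function `exp (F a)`, `F a = O(‖a‖²)`, has Bochner
mean `0`. -/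
lemma integral_eq_zero_of_charFun_eq_exp {μ : Measure H} [IsProbabilityMeasure μ] {F : H → ℂ}
    (hF : ∀ a, charFun μ a = Complex.exp (F a)) {C : ℝ} (hC : ∀ a, ‖F a‖ ≤ C * ‖a‖ ^ 2) :
    ∫ x, x ∂μ = 0 := by
  by_cases h_int : Integrable (fun x : H => x) μ
  swap
  · exact integral_undef h_int
  refine ext_inner_right ℝ fun a => ?_
  rw [inner_zero_left, real_inner_comm, ← integral_inner h_int]
  simp_rw [real_inner_comm _ a]
  set f : H → ℝ := fun x => ⟪x, a⟫_ℝ with hf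
  have hfm : Measurable f := by fun_prop
  have hchar : ∀ h : ℝ, charFun (μ.map f) h = Complex.exp (F (h • a)) := fun h => by
    rw [← hF, charFun_apply, charFun_apply, integral_map (by fun_prop) (by fun_prop)]
    simp [hf, inner_smul_right, mul_comm]
  have := Measure.isProbabilityMeasure_map (μ := μ) hfm.aemeasurable
  have hmem : MemLp id ((1 : ℕ) : ℝ≥0∞) (μ.map f) := by
    rw [memLp_map_measure_iff (by fun_prop) (by fun_prop), Nat.cast_one, memLp_one_iff_integrable]
    exact h_int.inner_const a
  have hder := iteratedDeriv_charFun_zero hmem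
  rw [iteratedDeriv_one] at hder
  have hF0 : HasDerivAt (fun h : ℝ => F (h • a)) 0 0 := by
    rw [hasDerivAt_iff_isLittleO]
    have hF00 : F 0 = 0 := by simpa using hC 0
    simp only [zero_smul, hF00, sub_zero, smul_zero]
    refine Asymptotics.IsBigO.trans_isLittleO (g := fun h : ℝ => h ^ 2) ?_ ?_
    · refine Asymptotics.IsBigO.of_bound (C * ‖a‖ ^ 2) (Eventually.of_forall fun h => ?_)
      refine (hC _).trans_eq ?_
      rw [norm_smul, norm_pow]
      ring
    · exact Asymptotics.isLittleO_pow_id one_lt_two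
  have h0 : deriv (charFun (μ.map f)) 0 = 0 := by
    rw [funext hchar]
    simpa using hF0.cexp.deriv
  rw [h0, integral_map (by fun_prop) (by fun_prop)] at hder
  simpa using hder

lemma IsC0.norm_integral_exponent_le {T : ℝ → H →L[ℝ] H} (hT : IsC0 T) {L : H → ℂ} {K : ℝ}
    (hK : 0 ≤ K) (hL : ∀ a, ‖L a‖ ≤ K * ‖a‖ ^ 2) {t : ℝ} (ht : 0 ≤ t) :
    ∃ C, ∀ a, ‖∫ s in (0 : ℝ)..t, L (ContinuousLinearMap.adjoint (T (max s 0)) a)‖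
      ≤ C * ‖a‖ ^ 2 := by
  obtain ⟨M, hM0, hM⟩ := hT.exists_norm_le t
  refine ⟨K * M ^ 2 * t, fun a => ?_⟩
  refine (intervalIntegral.norm_integral_le_of_norm_le_const (C := K * (M * ‖a‖) ^ 2)
    fun s hs => ?_).trans_eq ?_
  · rw [Set.uIoc_of_le ht] at hs
    refine (hL _).trans ?_
    gcongr
    refine ContinuousLinearMap.le_of_opNorm_le _ ?_ a
    rw [LinearIsometryEquiv.norm_map, max_eq_left hs.1.le]
    exact hM s ⟨hs.1.le, hs.2⟩
  · rw [sub_zero, abs_of_nonneg ht]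
    ring

end Properties

/-- **(3.2).** For a centered infinitely divisible probability measure `ν₀` on `H` with
finite second moment, `μ̂_t(a) = exp{∫_0^t log ν̂₀(T_s^* a) ds}` defines a centered
SC-semigroup `(μ_t)_{t≥0}` associated with `(T_t)` such that `t ↦ μ̂_t(a)` is
differentiable at `t = 0` for every `a ∈ H`. -/
theorem differentiable_sc_semigroup_from_infdiv
    {H : Type*} [NormedAddCommGroup H] [InnerProductSpace ℝ H] [CompleteSpace H]
    [MeasurableSpace H] [BorelSpace H] [SecondCountableTopology H]
    (T : ℝ → H →L[ℝ] H) (hT : IsC0 T)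
    (ν₀ : Measure H) (hν₀p : IsProbabilityMeasure ν₀)
    (hcent : ∫ x, x ∂ν₀ = 0)
    (hmom : ∫⁻ x, (‖x‖₊ : ℝ≥0∞) ^ 2 ∂ν₀ < ⊤)
    (hID : IsInfDiv ν₀)
    (L : H → ℂ) (hL : Continuous L) (hL0 : L 0 = 0)
    (hLexp : ∀ a : H, Complex.exp (L a) = charFn ν₀ a) :
    -- the formula defines a family of probability measures
    (∃ μ : ℝ → Measure H, (∀ t : ℝ, 0 ≤ t → IsProbabilityMeasure (μ t)) ∧
      ∀ t : ℝ, 0 ≤ t → ∀ a : H, charFn (μ t) a =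
        Complex.exp (∫ s in Set.Ioo 0 t, L ((ContinuousLinearMap.adjoint (T s)) a))) ∧
    -- and any such family is a centered SC-semigroup whose characteristic functionals
    -- are differentiable at `t = 0`
    (∀ μ : ℝ → Measure H, (∀ t : ℝ, 0 ≤ t → IsProbabilityMeasure (μ t)) →
      (∀ t : ℝ, 0 ≤ t → ∀ a : H, charFn (μ t) a =
        Complex.exp (∫ s in Set.Ioo 0 t, L ((ContinuousLinearMap.adjoint (T s)) a))) →
      IsSC T μ ∧
      (∀ t : ℝ, 0 ≤ t → ∫ x, x ∂(μ t) = 0) ∧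
      (∀ a : H, DifferentiableWithinAt ℝ (fun t => charFn (μ t) a) (Set.Ici 0) 0)) := by

  have hν₀ : IsCenteredSq ν₀ := by
    refine ⟨hν₀p, ⟨by fun_prop, ?_⟩, hcent⟩
    refine (eLpNorm_lt_top_iff_lintegral_rpow_enorm_lt_top (by norm_num) (by norm_num)).2 ?_
    simpa [enorm] using hmom
  have hcont := continuous_exponent_adjoint hT hID hν₀ hL hL0 hLexp
  refine ⟨?_, fun μ hμp hμ => ?_⟩
  · choose! μ hμp hμ using fun (t : ℝ) (ht : 0 ≤ t) =>
      exists_probabilityMeasure_charFun_eq hT hID hν₀ hL hL0 hLexp ht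
    refine ⟨μ, hμp, fun t ht a => ?_⟩
    rw [integral_Ioo_exponent_adjoint T L a ht, ← hμ t ht a]
    rfl
  have hchar : ∀ t : ℝ, 0 ≤ t → ∀ a, charFun (μ t) a = Complex.exp
      (∫ s in (0 : ℝ)..t, L (ContinuousLinearMap.adjoint (T (max s 0)) a)) := fun t ht a => by
    rw [← integral_Ioo_exponent_adjoint T L a ht, ← hμ t ht a]
    rfl
  refine ⟨⟨hμp, fun r t hr ht => ?_⟩, fun t ht => ?_, fun a => ?_⟩
  · have := hμp r hr
    have := hμp t ht
    have := hμp _ (add_nonneg hr ht)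
    have := Measure.isProbabilityMeasure_map (μ := μ r) (f := T t) (by fun_prop)
    change μ (r + t) = Measure.conv ((μ r).map (T t)) (μ t)
    refine Measure.ext_of_charFun (funext fun a => ?_)
    rw [charFun_conv, charFun_map_continuousLinearMap, hchar _ (add_nonneg hr ht), hchar r hr,
      hchar t ht, ← Complex.exp_add, hT.integral_add_eq hcont a hr ht]
  · have := hμp t ht
    obtain ⟨C, hC⟩ := hT.norm_integral_exponent_le (L := L) (K := 3 * ∫ x, ‖x‖ ^ 2 ∂ν₀)
      (by positivity)
      (fun a => (norm_exponent_le hID hν₀ hL hL0 hLexp a).trans_eq (by ring)) ht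
    exact integral_eq_zero_of_charFun_eq_exp (hchar t ht) hC
  · have hd : DifferentiableWithinAt ℝ (fun t : ℝ => Complex.exp
        (∫ s in (0 : ℝ)..t, L (ContinuousLinearMap.adjoint (T (max s 0)) a))) (Set.Ici 0) 0 :=
      ((hcont a).integral_hasStrictDerivAt 0 0).hasDerivAt.cexp.differentiableAt
        |>.differentiableWithinAt
    exact hd.congr (fun t ht => hchar t ht a) (hchar 0 le_rfl a)
end
end

section
/- The operators (T̃_t)_{t≥0} defined on the entrance space H̃ by (T̃_t x̃)(s) = x̃(t+s) satisfy: (i) T̃_t maps H̃ into H̃ and is a bounded linear operator with ‖T̃_t‖_∼ ≤ ‖T_t‖; (ii) J T_t x = T̃_t J x for all t ≥ 0 and x ∈ H; and (iii) (T̃_t)_{t≥0} is a strongly continuous semigroup of bounded linear operators on (H̃,‖·‖_∼). -/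
open MeasureTheory Real Filter
open scoped ENNReal InnerProductSpace NNReal

noncomputable section

/-- An entrance path for `(T_t)` (normalized to vanish on `(-∞,0]`). -/
def IsEntrance {H : Type*} [NormedAddCommGroup H] [NormedSpace ℝ H]
    (T : ℝ → H →L[ℝ] H) (x : ℝ → H) : Prop :=
  (∀ s : ℝ, s ≤ 0 → x s = 0) ∧ ∀ r t : ℝ, 0 < r → 0 < t → x (r + t) = T t (x r)

/-- Membership in the entrance space `H̃`: a locally square integrable entrance path. -/
def MemHt {H : Type*} [NormedAddCommGroup H] [NormedSpace ℝ H]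
    (T : ℝ → H →L[ℝ] H) (x : ℝ → H) : Prop :=
  IsEntrance T x ∧ ∃ l > (0:ℝ), ∫⁻ s in Set.Ioo 0 l, (‖x s‖₊ : ℝ≥0∞) ^ 2 < ⊤

/-- The map `J : H → H̃`, `Jx = {T_s x : s > 0}`. -/
def Jmap {H : Type*} [NormedAddCommGroup H] [NormedSpace ℝ H]
    (T : ℝ → H →L[ℝ] H) (x : H) : ℝ → H :=
  fun s => if 0 < s then T s x else 0

/-- The induced operator `T̃_t` on entrance paths: `(T̃_t x̃)(s) = x̃(t+s)`. -/
def shiftT {H : Type*} [NormedAddCommGroup H] (t : ℝ) (x : ℝ → H) : ℝ → H :=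
  fun s => if 0 < s then x (t + s) else 0

section EntrancePaths

variable {H : Type*} [NormedAddCommGroup H] [NormedSpace ℝ H] {T : ℝ → H →L[ℝ] H}
  {x : ℝ → H}

lemma IsEntrance.apply_add (hT : IsC0 T) (hx : IsEntrance T x) {r t : ℝ} (hr : 0 < r)
    (ht : 0 ≤ t) : x (r + t) = T t (x r) := by
  rcases ht.eq_or_lt with rfl | ht
  · simp [hT.1]
  · exact hx.2 r t hr ht

lemma IsEntrance.shiftT_apply (hT : IsC0 T) (hx : IsEntrance T x) {s t : ℝ} (hs : 0 < s)
    (ht : 0 ≤ t) : shiftT t x s = T t (x s) := by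
  rw [shiftT, if_pos hs, add_comm, hx.apply_add hT hs ht]

lemma IsEntrance.continuousOn (hT : IsC0 T) (hx : IsEntrance T x) :
    ContinuousOn x (Set.Ioi 0) := by
  intro s hs
  have hs : 0 < s := hs
  have h1 : ContinuousOn (fun u => T (u - s / 2) (x (s / 2))) (Set.Ici (s / 2)) :=
    (hT.2.2 (x (s / 2))).comp (by fun_prop) fun u hu => Set.mem_Ici.2 (sub_nonneg.2 hu)
  have h2 : ContinuousOn x (Set.Ici (s / 2)) := h1.congr fun u hu => by
    have := hx.apply_add hT (half_pos hs) (sub_nonneg.2 hu)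
    rwa [add_sub_cancel] at this
  exact (h2.continuousAt (Ici_mem_nhds (half_lt_self hs))).continuousWithinAt

lemma IsEntrance.continuousOn_shiftT (hT : IsC0 T) (hx : IsEntrance T x) {t : ℝ}
    (ht : 0 ≤ t) : ContinuousOn (shiftT t x) (Set.Ioi 0) :=
  ((T t).continuous.comp_continuousOn (hx.continuousOn hT)).congr fun _ hs =>
    hx.shiftT_apply hT hs ht

lemma IsEntrance.shiftT (hx : IsEntrance T x) {t : ℝ} (ht : 0 ≤ t) :
    IsEntrance T (shiftT t x) := by
  refine ⟨fun s hs => if_neg hs.not_gt, fun r u hr hu => ?_⟩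
  simp only [_root_.shiftT, if_pos hr, if_pos (add_pos hr hu)]
  rw [← add_assoc, hx.2 (t + r) u (by positivity) hu]

lemma IsEntrance.nnnorm_shiftT_sq_le (hT : IsC0 T) (hx : IsEntrance T x) {s t : ℝ}
    (hs : 0 < s) (ht : 0 ≤ t) :
    (‖_root_.shiftT t x s‖₊ : ℝ≥0∞) ^ 2 ≤ ENNReal.ofReal (‖T t‖ ^ 2) * (‖x s‖₊ : ℝ≥0∞) ^ 2 := by
  rw [hx.shiftT_apply hT hs ht, ENNReal.ofReal_pow (norm_nonneg _), ofReal_norm,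
    ← mul_pow]
  gcongr
  exact (T t).le_opENorm (x s)

lemma MemHt.shiftT (hT : IsC0 T) (hx : MemHt T x) {t : ℝ} (ht : 0 ≤ t) :
    MemHt T (shiftT t x) := by
  obtain ⟨hE, l, hl, hfin⟩ := hx
  refine ⟨hE.shiftT ht, l, hl, ?_⟩
  calc ∫⁻ s in Set.Ioo 0 l, (‖_root_.shiftT t x s‖₊ : ℝ≥0∞) ^ 2
      ≤ ∫⁻ s in Set.Ioo 0 l, ENNReal.ofReal (‖T t‖ ^ 2) * (‖x s‖₊ : ℝ≥0∞) ^ 2 :=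
        setLIntegral_mono' measurableSet_Ioo fun s hs => hE.nnnorm_shiftT_sq_le hT hs.1 ht
    _ = ENNReal.ofReal (‖T t‖ ^ 2) * ∫⁻ s in Set.Ioo 0 l, (‖x s‖₊ : ℝ≥0∞) ^ 2 :=
        lintegral_const_mul' _ _ ENNReal.ofReal_ne_top
    _ < ⊤ := ENNReal.mul_lt_top ENNReal.ofReal_lt_top hfin

lemma MemHt.lintegral_shiftT_le (hT : IsC0 T) (hx : MemHt T x) {t : ℝ} (ht : 0 ≤ t)
    (w : ℝ → ℝ≥0∞) :
    ∫⁻ s in Set.Ioi 0, w s * (‖_root_.shiftT t x s‖₊ : ℝ≥0∞) ^ 2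
      ≤ ENNReal.ofReal (‖T t‖ ^ 2) * ∫⁻ s in Set.Ioi 0, w s * (‖x s‖₊ : ℝ≥0∞) ^ 2 := by
  rw [← lintegral_const_mul' _ _ ENNReal.ofReal_ne_top]
  refine setLIntegral_mono' measurableSet_Ioi fun s hs => ?_
  rw [mul_left_comm]
  gcongr
  exact hx.1.nnnorm_shiftT_sq_le hT hs ht

/-- The weighted norm of a locally square integrable entrance path is finite. -/
lemma MemHt.lintegral_lt_top {c₀ b₀ b : ℝ} (hb₀ : 0 ≤ b₀)
    (hb : b₀ < b) (hT : IsC0 T) (hbd : ∀ t : ℝ, 0 ≤ t → ‖T t‖ ≤ c₀ * Real.exp (b₀ * t))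
    (hx : MemHt T x) :
    ∫⁻ s in Set.Ioi 0, ENNReal.ofReal (Real.exp (-2 * b * s) * ‖x s‖ ^ 2) < ⊤ := by
  obtain ⟨hE, l, hl, hfin⟩ := hx
  have hsub : Set.Ioi (0 : ℝ) ⊆ Set.Ioo 0 l ∪ Set.Ioi (l / 2) := fun s hs => by
    rcases lt_or_ge s l with h | h
    · exact Or.inl ⟨hs, h⟩
    · exact Or.inr (lt_of_lt_of_le (half_lt_self hl) h)
  refine (lintegral_mono_set hsub).trans_lt ((lintegral_union_le _ _ _).trans_lt
    (ENNReal.add_lt_top.2 ⟨?_, ?_⟩))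
  · refine lt_of_le_of_lt (setLIntegral_mono' measurableSet_Ioo fun s hs => ?_) hfin
    have h : (‖x s‖₊ : ℝ≥0∞) ^ 2 = ENNReal.ofReal (‖x s‖ ^ 2) := by
      rw [ENNReal.ofReal_pow (norm_nonneg _), ofReal_norm]; rfl
    rw [h]
    refine ENNReal.ofReal_le_ofReal (mul_le_of_le_one_left (by positivity) ?_)
    exact Real.exp_le_one_iff.2 (by nlinarith [mul_pos (hb₀.trans_lt hb) hs.1])
  · have hint : IntegrableOn (fun s => (c₀ * ‖x (l / 2)‖) ^ 2 * Real.exp (-(2 * (b - b₀)) * s))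
        (Set.Ioi (l / 2)) :=
      (exp_neg_integrableOn_Ioi (l / 2) (by linarith)).const_mul _
    refine lt_of_le_of_lt (setLIntegral_mono' measurableSet_Ioi fun s hs => ?_)
      hint.lintegral_lt_top
    have hs : l / 2 < s := hs
    refine ENNReal.ofReal_le_ofReal ?_
    have hxs := hE.apply_add hT (half_pos hl) (sub_nonneg.2 hs.le)
    rw [add_sub_cancel] at hxs
    have hc₀ : 0 ≤ c₀ := by simpa using (norm_nonneg _).trans (hbd 0 le_rfl)
    have hT' : ‖T (s - l / 2)‖ ≤ c₀ * Real.exp (b₀ * s) :=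
      (hbd _ (sub_nonneg.2 hs.le)).trans (by gcongr; linarith)
    have hn : ‖x s‖ ≤ c₀ * Real.exp (b₀ * s) * ‖x (l / 2)‖ :=
      hxs ▸ (T (s - l / 2)).le_of_opNorm_le hT' _
    calc Real.exp (-2 * b * s) * ‖x s‖ ^ 2
        ≤ Real.exp (-2 * b * s) * (c₀ * Real.exp (b₀ * s) * ‖x (l / 2)‖) ^ 2 := by gcongr
      _ = (c₀ * ‖x (l / 2)‖) ^ 2 * (Real.exp (-2 * b * s) * Real.exp (b₀ * s) ^ 2) := by ring
      _ = (c₀ * ‖x (l / 2)‖) ^ 2 * Real.exp (-(2 * (b - b₀)) * s) := by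
        rw [← Real.exp_nat_mul, ← Real.exp_add]
        congr 2
        push_cast
        ring

lemma MemHt.tendsto_shiftT {c₀ b₀ b : ℝ} (hb₀ : 0 ≤ b₀) (hb : b₀ < b)
    (hT : IsC0 T) (hbd : ∀ t : ℝ, 0 ≤ t → ‖T t‖ ≤ c₀ * Real.exp (b₀ * t)) (hx : MemHt T x) :
    Tendsto (fun t => ∫⁻ s in Set.Ioi 0,
        ENNReal.ofReal (Real.exp (-2 * b * s) * ‖_root_.shiftT t x s - x s‖ ^ 2))
      (nhdsWithin 0 (Set.Ioi 0)) (nhds 0) := by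
  have hc₀ : 0 ≤ c₀ := by simpa using (norm_nonneg _).trans (hbd 0 le_rfl)
  set K := (c₀ * Real.exp b₀ + 1) ^ 2
  rw [← lintegral_zero (μ := volume.restrict (Set.Ioi (0 : ℝ)))]
  refine tendsto_lintegral_filter_of_dominated_convergence'
    (fun s => ENNReal.ofReal K * ENNReal.ofReal (Real.exp (-2 * b * s) * ‖x s‖ ^ 2)) ?_ ?_ ?_ ?_
  · filter_upwards [self_mem_nhdsWithin] with t ht
    have h1 := hx.1.continuousOn hT
    have h2 := hx.1.continuousOn_shiftT hT (Set.mem_Ioi.1 ht).le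
    have h3 : ContinuousOn (fun s => Real.exp (-2 * b * s) * ‖_root_.shiftT t x s - x s‖ ^ 2)
      (Set.Ioi 0) := by fun_prop
    exact (h3.aemeasurable measurableSet_Ioi).ennreal_ofReal
  · filter_upwards [Ioo_mem_nhdsGT one_pos] with t ht
    filter_upwards [ae_restrict_mem measurableSet_Ioi] with s hs
    rw [← ENNReal.ofReal_mul (sq_nonneg _)]
    refine ENNReal.ofReal_le_ofReal ?_
    have hT' : ‖T t‖ ≤ c₀ * Real.exp b₀ := (hbd t ht.1.le).trans (by
      gcongr; exact mul_le_of_le_one_right hb₀ ht.2.le)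
    have hn : ‖_root_.shiftT t x s - x s‖ ≤ (c₀ * Real.exp b₀ + 1) * ‖x s‖ := by
      rw [hx.1.shiftT_apply hT hs ht.1.le, add_mul, one_mul]
      exact (norm_sub_le _ _).trans (by gcongr; exact (T t).le_of_opNorm_le hT' _)
    calc Real.exp (-2 * b * s) * ‖_root_.shiftT t x s - x s‖ ^ 2
        ≤ Real.exp (-2 * b * s) * ((c₀ * Real.exp b₀ + 1) * ‖x s‖) ^ 2 := by gcongr
      _ = K * (Real.exp (-2 * b * s) * ‖x s‖ ^ 2) := by ring
  · rw [lintegral_const_mul' _ _ ENNReal.ofReal_ne_top]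
    exact (ENNReal.mul_lt_top ENNReal.ofReal_lt_top (hx.lintegral_lt_top hb₀ hb hT hbd)).ne
  · filter_upwards [ae_restrict_mem measurableSet_Ioi] with s hs
    have h1 : Tendsto (fun t => T t (x s)) (nhdsWithin 0 (Set.Ioi 0)) (nhds (x s)) := by
      have h : Tendsto (fun t => T t (x s)) (nhdsWithin 0 (Set.Ici 0)) (nhds (T 0 (x s))) :=
        hT.2.2 (x s) 0 Set.self_mem_Ici
      rw [hT.1] at h
      exact h.mono_left (nhdsWithin_mono _ Set.Ioi_subset_Ici_self)
    have h2 : Tendsto (fun t => _root_.shiftT t x s) (nhdsWithin 0 (Set.Ioi 0)) (nhds (x s)) :=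
      h1.congr' (by
        filter_upwards [self_mem_nhdsWithin] with t ht
        exact (hx.1.shiftT_apply hT hs (Set.mem_Ioi.1 ht).le).symm)
    simpa using ENNReal.tendsto_ofReal
      (((h2.sub_const (x s)).norm.pow 2).const_mul (Real.exp (-2 * b * s)))

end EntrancePaths

/-- **(3.3) and Lemma 3.1.** The operators `(T̃_t x̃)(s) = x̃(t+s)` form a strongly
continuous semigroup of bounded linear operators on `(H̃,‖·‖_∼)` with
`‖T̃_t‖_∼ ≤ ‖T_t‖`, and `J T_t x = T̃_t J x` for all `t ≥ 0`, `x ∈ H`. -/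
theorem shift_semigroup_on_entrance_space
    {H : Type*} [NormedAddCommGroup H] [InnerProductSpace ℝ H] [CompleteSpace H]
    (T : ℝ → H →L[ℝ] H) (c₀ b₀ b : ℝ) (hc₀ : 0 ≤ c₀) (hb₀ : 0 ≤ b₀) (hb : b₀ < b)
    (hT : IsC0 T) (hbd : ∀ t : ℝ, 0 ≤ t → ‖T t‖ ≤ c₀ * Real.exp (b₀ * t)) :
    -- (i) `T̃_t` maps `H̃` into `H̃` …
    (∀ t : ℝ, 0 ≤ t → ∀ x : ℝ → H, MemHt T x → MemHt T (shiftT t x)) ∧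
    -- … is linear …
    (∀ t : ℝ, ∀ x y : ℝ → H, shiftT t (x + y) = shiftT t x + shiftT t y) ∧
    (∀ t : ℝ, ∀ (c : ℝ) (x : ℝ → H), shiftT t (c • x) = c • shiftT t x) ∧
    -- … and is bounded with `‖T̃_t x̃‖_∼² ≤ ‖T_t‖² ‖x̃‖_∼²`
    (∀ t : ℝ, 0 ≤ t → ∀ x : ℝ → H, MemHt T x →
      ∫⁻ s in Set.Ioi 0,
          ENNReal.ofReal (Real.exp (-2 * b * s)) * (‖shiftT t x s‖₊ : ℝ≥0∞) ^ 2
        ≤ ENNReal.ofReal (‖T t‖ ^ 2) *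
          ∫⁻ s in Set.Ioi 0,
            ENNReal.ofReal (Real.exp (-2 * b * s)) * (‖x s‖₊ : ℝ≥0∞) ^ 2) ∧
    -- (ii) `J T_t x = T̃_t J x`
    (∀ t : ℝ, 0 ≤ t → ∀ x : H, Jmap T (T t x) = shiftT t (Jmap T x)) ∧
    -- (iii) semigroup property: `T̃_0 = I` on `H̃` and `T̃_{t₁+t₂} = T̃_{t₁} T̃_{t₂}`
    (∀ x : ℝ → H, MemHt T x → shiftT 0 x = x) ∧
    (∀ t₁ t₂ : ℝ, 0 ≤ t₁ → 0 ≤ t₂ → ∀ x : ℝ → H, MemHt T x →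
      shiftT (t₁ + t₂) x = shiftT t₁ (shiftT t₂ x)) ∧
    -- strong continuity: `‖T̃_t x̃ - x̃‖_∼ → 0` as `t → 0⁺`
    (∀ x : ℝ → H, MemHt T x →
      Tendsto (fun t => ∫⁻ s in Set.Ioi 0,
          ENNReal.ofReal (Real.exp (-2 * b * s) * ‖shiftT t x s - x s‖ ^ 2))
        (nhdsWithin 0 (Set.Ioi 0)) (nhds 0)) := by
  refine ⟨fun t ht x hx => hx.shiftT hT ht, fun t x y => ?_, fun t c x => ?_,
    fun t ht x hx => hx.lintegral_shiftT_le hT ht _, fun t ht x => ?_, fun x hx => ?_,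
    fun t₁ t₂ ht₁ ht₂ x hx => ?_, fun x hx => hx.tendsto_shiftT hb₀ hb hT hbd⟩
  · funext s
    by_cases hs : 0 < s <;> simp [shiftT, hs]
  · funext s
    by_cases hs : 0 < s <;> simp [shiftT, hs]
  · funext s
    by_cases hs : 0 < s
    · have hts : 0 < t + s := by positivity
      simp only [shiftT, Jmap, if_pos hs, if_pos hts]
      rw [add_comm, hT.2.1 s t hs.le ht, ContinuousLinearMap.comp_apply]
    · simp [shiftT, Jmap, hs]
  · funext s
    by_cases hs : 0 < s
    · simp [shiftT, hs]
    · simp [shiftT, hs, hx.1.1 s (not_lt.1 hs)]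
  · funext s
    by_cases hs : 0 < s
    · have hts : 0 < t₁ + s := by positivity
      simp only [shiftT, if_pos hs, if_pos hts]
      congr 1
      ring
    · simp [shiftT, hs]
end
end
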